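/- Let (M,𝒳) ⊨ RCA0, ℱ the class of total functions M→M in 𝒳, and 𝒰 an ultrafilter on 𝒳 all of whose elements are cofinal in M. For each n ≥ 1, if (M,𝒳) satisfies Σ_n-comprehension, then every instance of Σ_n- and Π_n-comprehension true in (M,𝒳) transfers to the restricted ultrapower: for any first-order formula φ(x) in Σ_n or Π_n with parameters from M, if there is A ∈ 𝒳 with (M,𝒳) ⊨ ∀x (x ∈ A ↔ φ(x)), then (ℱ/𝒰,𝒳) ⊨ ∀x (x ∈ A ↔ φ(x)). -/

import Mathlib

namespace PaperArith

/-! ## Syntax of (two-sorted) first-order arithmetic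

Terms and formulas of arithmetic in the language `{0, 1, +, ·, <}`,
with number variables and (monadic second-order) set variables both indexed
by natural numbers.  Bounded quantifiers are taken as primitives, so that the
class `Δ₀` of bounded formulas is a purely syntactic class. -/

/-- Terms of first-order arithmetic in the language `{0, 1, +, ·, <}`. -/
inductive Term : Type
  | var : ℕ → Term
  | zero : Term
  | one : Term
  | add : Term → Term → Term
  | mul : Term → Term → Term

/-- Formulas of (two-sorted) arithmetic.  `mem t i` is the atomic formula
`t ∈ Xᵢ`; `ball x t φ` is `∀ x < t, φ` and `bex x t φ` is `∃ x < t, φ`;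
`sall i φ` and `sex i φ` quantify over the set variable `Xᵢ`.
Purely first-order formulas are those avoiding `mem`, `sall`, `sex`. -/
inductive Fml : Type
  | eq : Term → Term → Fml
  | lt : Term → Term → Fml
  | mem : Term → ℕ → Fml
  | not : Fml → Fml
  | and : Fml → Fml → Fml
  | or : Fml → Fml → Fml
  | imp : Fml → Fml → Fml
  | all : ℕ → Fml → Fml
  | ex : ℕ → Fml → Fml
  | ball : ℕ → Term → Fml → Fml
  | bex : ℕ → Term → Fml → Fml
  | sall : ℕ → Fml → Fml
  | sex : ℕ → Fml → Fml

/-- A structure for the first-order language of arithmetic. -/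
structure Str : Type 1 where
  M : Type
  zero : M
  one : M
  add : M → M → M
  mul : M → M → M
  lt : M → M → Prop

/-- Value of a term under a valuation of the number variables. -/
def tval (S : Str) (v : ℕ → S.M) : Term → S.M
  | .var i => v i
  | .zero => S.zero
  | .one => S.one
  | .add t u => S.add (tval S v t) (tval S v u)
  | .mul t u => S.mul (tval S v t) (tval S v u)

/-- Update a valuation at one variable. -/
def upd {α : Type} (v : ℕ → α) (x : ℕ) (a : α) : ℕ → α :=
  fun i => if i = x then a else v i

/-- Tarskian satisfaction over the structure `S`, with second-order universe
`X` (set quantifiers range over `X`); `v` is the valuation of number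
variables, `w` the valuation of set variables. -/
def Sat (S : Str) (X : Set (Set S.M)) : (ℕ → S.M) → (ℕ → Set S.M) → Fml → Prop
  | v, _, .eq t u => tval S v t = tval S v u
  | v, _, .lt t u => S.lt (tval S v t) (tval S v u)
  | v, w, .mem t i => tval S v t ∈ w i
  | v, w, .not φ => ¬ Sat S X v w φ
  | v, w, .and φ ψ => Sat S X v w φ ∧ Sat S X v w ψ
  | v, w, .or φ ψ => Sat S X v w φ ∨ Sat S X v w ψ
  | v, w, .imp φ ψ => Sat S X v w φ → Sat S X v w ψ
  | v, w, .all x φ => ∀ m : S.M, Sat S X (upd v x m) w φ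
  | v, w, .ex x φ => ∃ m : S.M, Sat S X (upd v x m) w φ
  | v, w, .ball x t φ => ∀ m : S.M, S.lt m (tval S v t) → Sat S X (upd v x m) w φ
  | v, w, .bex x t φ => ∃ m : S.M, S.lt m (tval S v t) ∧ Sat S X (upd v x m) w φ
  | v, w, .sall i φ => ∀ A : Set S.M, A ∈ X → Sat S X v (upd w i A) φ
  | v, w, .sex i φ => ∃ A : Set S.M, A ∈ X ∧ Sat S X v (upd w i A) φ

/-- First-order satisfaction (for purely first-order formulas the second-order
data is irrelevant). -/
def Sat0 (S : Str) (v : ℕ → S.M) (φ : Fml) : Prop :=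
  Sat S ∅ v (fun _ => ∅) φ

/-! ## The arithmetic hierarchy -/

/-- `Δ₀` formulas: purely first-order, only bounded quantifiers. -/
inductive Delta0 : Fml → Prop
  | eq (t u : Term) : Delta0 (.eq t u)
  | lt (t u : Term) : Delta0 (.lt t u)
  | not {φ : Fml} : Delta0 φ → Delta0 (.not φ)
  | and {φ ψ : Fml} : Delta0 φ → Delta0 ψ → Delta0 (.and φ ψ)
  | or {φ ψ : Fml} : Delta0 φ → Delta0 ψ → Delta0 (.or φ ψ)
  | imp {φ ψ : Fml} : Delta0 φ → Delta0 ψ → Delta0 (.imp φ ψ)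
  | ball (x : ℕ) (t : Term) {φ : Fml} : Delta0 φ → Delta0 (.ball x t φ)
  | bex (x : ℕ) (t : Term) {φ : Fml} : Delta0 φ → Delta0 (.bex x t φ)

mutual
  /-- `Σₙ` formulas of the first-order arithmetic hierarchy. -/
  inductive IsSigma : ℕ → Fml → Prop
    | delta0 {n : ℕ} {φ : Fml} : Delta0 φ → IsSigma n φ
    | ofPi {n : ℕ} {φ : Fml} : IsPi n φ → IsSigma (n + 1) φ
    | ex (x : ℕ) {n : ℕ} {φ : Fml} : IsSigma (n + 1) φ → IsSigma (n + 1) (.ex x φ)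
  /-- `Πₙ` formulas of the first-order arithmetic hierarchy. -/
  inductive IsPi : ℕ → Fml → Prop
    | delta0 {n : ℕ} {φ : Fml} : Delta0 φ → IsPi n φ
    | ofSigma {n : ℕ} {φ : Fml} : IsSigma n φ → IsPi (n + 1) φ
    | all (x : ℕ) {n : ℕ} {φ : Fml} : IsPi (n + 1) φ → IsPi (n + 1) (.all x φ)
end

/-- `Σ₀(Σₙ)`: the closure of `Σₙ` under Boolean operations and bounded
quantification. -/
inductive Sigma0Sigma (n : ℕ) : Fml → Prop
  | ofSigma {φ : Fml} : IsSigma n φ → Sigma0Sigma n φ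
  | not {φ : Fml} : Sigma0Sigma n φ → Sigma0Sigma n (.not φ)
  | and {φ ψ : Fml} : Sigma0Sigma n φ → Sigma0Sigma n ψ → Sigma0Sigma n (.and φ ψ)
  | or {φ ψ : Fml} : Sigma0Sigma n φ → Sigma0Sigma n ψ → Sigma0Sigma n (.or φ ψ)
  | imp {φ ψ : Fml} : Sigma0Sigma n φ → Sigma0Sigma n ψ → Sigma0Sigma n (.imp φ ψ)
  | ball (x : ℕ) (t : Term) {φ : Fml} : Sigma0Sigma n φ → Sigma0Sigma n (.ball x t φ)
  | bex (x : ℕ) (t : Term) {φ : Fml} : Sigma0Sigma n φ → Sigma0Sigma n (.bex x t φ)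

/-- The class `Σₙ ∧ Πₙ` of conjunctions of a `Σₙ` and a `Πₙ` formula. -/
def SigmaAndPi (n : ℕ) (φ : Fml) : Prop :=
  ∃ ψ χ : Fml, IsSigma n ψ ∧ IsPi n χ ∧ φ = Fml.and ψ χ

/-- The class `Σₙ ∨ Πₙ` of disjunctions of a `Σₙ` and a `Πₙ` formula. -/
def SigmaOrPi (n : ℕ) (φ : Fml) : Prop :=
  ∃ ψ χ : Fml, IsSigma n ψ ∧ IsPi n χ ∧ φ = Fml.or ψ χ

/-- `Δ₀⁰` formulas of second-order arithmetic: only bounded first-order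
quantifiers; free set variables (set parameters) are allowed. -/
inductive Delta0SO : Fml → Prop
  | eq (t u : Term) : Delta0SO (.eq t u)
  | lt (t u : Term) : Delta0SO (.lt t u)
  | mem (t : Term) (i : ℕ) : Delta0SO (.mem t i)
  | not {φ : Fml} : Delta0SO φ → Delta0SO (.not φ)
  | and {φ ψ : Fml} : Delta0SO φ → Delta0SO ψ → Delta0SO (.and φ ψ)
  | or {φ ψ : Fml} : Delta0SO φ → Delta0SO ψ → Delta0SO (.or φ ψ)
  | imp {φ ψ : Fml} : Delta0SO φ → Delta0SO ψ → Delta0SO (.imp φ ψ)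
  | ball (x : ℕ) (t : Term) {φ : Fml} : Delta0SO φ → Delta0SO (.ball x t φ)
  | bex (x : ℕ) (t : Term) {φ : Fml} : Delta0SO φ → Delta0SO (.bex x t φ)

mutual
  /-- `Σₙ⁰` formulas of the second-order arithmetic hierarchy
  (set parameters allowed, no set quantifiers). -/
  inductive SigmaSO : ℕ → Fml → Prop
    | delta0 {n : ℕ} {φ : Fml} : Delta0SO φ → SigmaSO n φ
    | ofPi {n : ℕ} {φ : Fml} : PiSO n φ → SigmaSO (n + 1) φ
    | ex (x : ℕ) {n : ℕ} {φ : Fml} : SigmaSO (n + 1) φ → SigmaSO (n + 1) (.ex x φ)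
  /-- `Πₙ⁰` formulas of the second-order arithmetic hierarchy. -/
  inductive PiSO : ℕ → Fml → Prop
    | delta0 {n : ℕ} {φ : Fml} : Delta0SO φ → PiSO n φ
    | ofSigma {n : ℕ} {φ : Fml} : SigmaSO n φ → PiSO (n + 1) φ
    | all (x : ℕ) {n : ℕ} {φ : Fml} : PiSO (n + 1) φ → PiSO (n + 1) (.all x φ)
end

/-! ## First-order theories -/

/-- `PA⁻`: the theory of non-negative parts of discretely ordered rings. -/
structure PAminus (S : Str) : Prop where
  add_assoc : ∀ a b c, S.add (S.add a b) c = S.add a (S.add b c)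
  add_comm : ∀ a b, S.add a b = S.add b a
  mul_assoc : ∀ a b c, S.mul (S.mul a b) c = S.mul a (S.mul b c)
  mul_comm : ∀ a b, S.mul a b = S.mul b a
  distrib : ∀ a b c, S.mul a (S.add b c) = S.add (S.mul a b) (S.mul a c)
  add_zero : ∀ a, S.add a S.zero = a
  mul_zero : ∀ a, S.mul a S.zero = S.zero
  mul_one : ∀ a, S.mul a S.one = a
  lt_irrefl : ∀ a, ¬ S.lt a a
  lt_trans : ∀ a b c, S.lt a b → S.lt b c → S.lt a c
  lt_total : ∀ a b, S.lt a b ∨ a = b ∨ S.lt b a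
  add_lt_add : ∀ a b c, S.lt a b → S.lt (S.add a c) (S.add b c)
  mul_lt_mul : ∀ a b c, S.lt a b → S.lt S.zero c → S.lt (S.mul a c) (S.mul b c)
  zero_lt_one : S.lt S.zero S.one
  zero_le : ∀ a, a = S.zero ∨ S.lt S.zero a
  discrete : ∀ a b, S.lt a b → S.add a S.one = b ∨ S.lt (S.add a S.one) b
  pred : ∀ a, S.lt S.zero a → ∃ b, S.add b S.one = a
  sub : ∀ a b, S.lt a b → ∃ c, S.add a c = b

/-- The induction scheme for the class `Γ` of formulas
(parameters are allowed via the ambient valuation `v`). -/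
def IndFor (S : Str) (Γ : Fml → Prop) : Prop :=
  ∀ φ : Fml, Γ φ → ∀ (v : ℕ → S.M) (x : ℕ),
    Sat0 S (upd v x S.zero) φ →
    (∀ m, Sat0 S (upd v x m) φ → Sat0 S (upd v x (S.add m S.one)) φ) →
    ∀ m, Sat0 S (upd v x m) φ

/-- The collection scheme for the class `Γ`:
`(∀ x < a ∃ y φ) → (∃ b ∀ x < a ∃ y < b φ)`. -/
def CollFor (S : Str) (Γ : Fml → Prop) : Prop :=
  ∀ φ : Fml, Γ φ → ∀ (v : ℕ → S.M) (x y : ℕ), x ≠ y → ∀ a : S.M,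
    (∀ m, S.lt m a → ∃ k, Sat0 S (upd (upd v x m) y k) φ) →
    ∃ b, ∀ m, S.lt m a → ∃ k, S.lt k b ∧ Sat0 S (upd (upd v x m) y k) φ

/-- `IΔ₀` (over `PA⁻`). -/
def IDelta0 (S : Str) : Prop := PAminus S ∧ IndFor S Delta0

/-- `IΣₙ` (over `PA⁻`; note `Δ₀ ⊆ Σₙ`, so this includes `IΔ₀`). -/
def ISigma (S : Str) (n : ℕ) : Prop := PAminus S ∧ IndFor S (IsSigma n)

/-- `BΣₙ`: the `Σₙ`-collection scheme, including `IΔ₀` (over `PA⁻`). -/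
def BSigma (S : Str) (n : ℕ) : Prop := IDelta0 S ∧ CollFor S (IsSigma n)

/-- The weak regularity principle `WRφ` for all `φ` in the class `Γ`:
the universal closure of `(∀ x ∃ y < a φ(x,y)) → (∃ y < a ∀ b ∃ x > b φ(x,y))`.
Here `x, y` are the two displayed variables and all other free variables of
`φ` are parameters, interpreted by the ambient valuation `v`. -/
def WRFor (S : Str) (Γ : Fml → Prop) : Prop :=
  ∀ φ : Fml, Γ φ → ∀ (v : ℕ → S.M) (x y : ℕ), x ≠ y → ∀ a : S.M,
    (∀ m, ∃ k, S.lt k a ∧ Sat0 S (upd (upd v x m) y k) φ) →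
    ∃ k, S.lt k a ∧ ∀ b, ∃ m, S.lt b m ∧ Sat0 S (upd (upd v x m) y k) φ

/-! ## Second-order theories -/

/-- Second-order induction scheme for the class `Γ`, with set parameters
from the second-order universe `X`. -/
def IndForSO (S : Str) (X : Set (Set S.M)) (Γ : Fml → Prop) : Prop :=
  ∀ φ : Fml, Γ φ → ∀ (v : ℕ → S.M) (w : ℕ → Set S.M), (∀ i, w i ∈ X) → ∀ x : ℕ,
    Sat S X (upd v x S.zero) w φ →
    (∀ m, Sat S X (upd v x m) w φ → Sat S X (upd v x (S.add m S.one)) w φ) →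
    ∀ m, Sat S X (upd v x m) w φ

/-- Second-order collection scheme for the class `Γ`. -/
def CollForSO (S : Str) (X : Set (Set S.M)) (Γ : Fml → Prop) : Prop :=
  ∀ φ : Fml, Γ φ → ∀ (v : ℕ → S.M) (w : ℕ → Set S.M), (∀ i, w i ∈ X) →
    ∀ (x y : ℕ), x ≠ y → ∀ a : S.M,
    (∀ m, S.lt m a → ∃ k, Sat S X (upd (upd v x m) y k) w φ) →
    ∃ b, ∀ m, S.lt m a → ∃ k, S.lt k b ∧ Sat S X (upd (upd v x m) y k) w φ

/-- `Δ₁⁰`-comprehension. -/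
def Delta1CA (S : Str) (X : Set (Set S.M)) : Prop :=
  ∀ φ ψ : Fml, SigmaSO 1 φ → PiSO 1 ψ →
    ∀ (v : ℕ → S.M) (w : ℕ → Set S.M), (∀ i, w i ∈ X) → ∀ x : ℕ,
    (∀ m, Sat S X (upd v x m) w φ ↔ Sat S X (upd v x m) w ψ) →
    ∃ A ∈ X, ∀ m, m ∈ A ↔ Sat S X (upd v x m) w φ

/-- `Σₙ`-comprehension for first-order formulas with parameters from `M`. -/
def SigmaCA (S : Str) (X : Set (Set S.M)) (n : ℕ) : Prop :=
  ∀ φ : Fml, IsSigma n φ → ∀ (v : ℕ → S.M) (x : ℕ),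
    ∃ A ∈ X, ∀ m, m ∈ A ↔ Sat0 S (upd v x m) φ

/-- `RCA₀`. -/
def RCA0 (S : Str) (X : Set (Set S.M)) : Prop :=
  PAminus S ∧ IndForSO S X (SigmaSO 1) ∧ Delta1CA S X

/-- `Σ₁⁰`-separation; over `RCA₀` this is equivalent to weak Kőnig's lemma. -/
def Sigma1Sep (S : Str) (X : Set (Set S.M)) : Prop :=
  ∀ φ ψ : Fml, SigmaSO 1 φ → SigmaSO 1 ψ →
    ∀ (v : ℕ → S.M) (w : ℕ → Set S.M), (∀ i, w i ∈ X) → ∀ x : ℕ,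
    (∀ m, ¬ (Sat S X (upd v x m) w φ ∧ Sat S X (upd v x m) w ψ)) →
    ∃ A ∈ X, ∀ m, (Sat S X (upd v x m) w φ → m ∈ A) ∧ (m ∈ A → ¬ Sat S X (upd v x m) w ψ)

/-- `WKL₀`, rendered as `RCA₀` plus `Σ₁⁰`-separation (which is equivalent,
over `RCA₀`, to weak Kőnig's lemma). -/
def WKL0 (S : Str) (X : Set (Set S.M)) : Prop := RCA0 S X ∧ Sigma1Sep S X

/-- `BΣₙ⁰`: the second-order `Σₙ⁰`-collection scheme (including `IΔ₀⁰`,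
over `PA⁻`). -/
def BSigmaSO (S : Str) (X : Set (Set S.M)) (n : ℕ) : Prop :=
  PAminus S ∧ IndForSO S X Delta0SO ∧ CollForSO S X (SigmaSO n)

/-- `IΣₙ⁰`: the second-order `Σₙ⁰`-induction scheme, over `RCA₀`. -/
def ISigmaSO (S : Str) (X : Set (Set S.M)) (n : ℕ) : Prop :=
  RCA0 S X ∧ IndForSO S X (SigmaSO n)

/-! ## Exponentiation and binary digits -/

/-- Satisfaction of a three-variable formula `E(x₀, x₁, x₂)` at `(a, b, c)`. -/
def ExpAt (S : Str) (E : Fml) (a b c : S.M) : Prop :=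
  Sat0 S (fun i => if i = 0 then a else if i = 1 then b else c) E

/-- `E(x₀,x₁,x₂)` is a `Δ₀` definition of the (total) exponentiation function
`x₀ ^ x₁ = x₂`.  The existence of such an `E` expresses `exp`
(the totality of exponentiation). -/
structure IsExpDef (S : Str) (E : Fml) : Prop where
  delta0 : Delta0 E
  base : ∀ a, ExpAt S E a S.zero S.one
  total : ∀ a b, ∃ c, ExpAt S E a b c
  unique : ∀ a b c c', ExpAt S E a b c → ExpAt S E a b c' → c = c'
  step : ∀ a b c, ExpAt S E a b c → ExpAt S E a (S.add b S.one) (S.mul c a)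

/-- `exp`: the totality of exponentiation (via a `Δ₀` definition of its
graph). -/
def SatExp (S : Str) : Prop := ∃ E : Fml, IsExpDef S E

/-! ## Embeddings, end extensions and elementarity -/

/-- An embedding of arithmetic structures. -/
structure Emb (S K : Str) where
  j : S.M → K.M
  inj : Function.Injective j
  zero : j S.zero = K.zero
  one : j S.one = K.one
  add : ∀ a b, j (S.add a b) = K.add (j a) (j b)
  mul : ∀ a b, j (S.mul a b) = K.mul (j a) (j b)
  lt_iff : ∀ a b, S.lt a b ↔ K.lt (j a) (j b)

/-- The extension along `e` is an end extension: every element of `K` not in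
the image of `M` exceeds every element of `M`. -/
def IsEndExt {S K : Str} (e : Emb S K) : Prop :=
  ∀ b : K.M, b ∉ Set.range e.j → ∀ a : S.M, K.lt (e.j a) b

/-- The extension along `e` is proper. -/
def IsProper {S K : Str} (e : Emb S K) : Prop := ¬ Function.Surjective e.j

/-- The extension along `e` is `Σₙ`-elementary: all `Σₙ` formulas with
parameters from `M` are absolute between `M` and `K`. -/
def SigmaElem {S K : Str} (e : Emb S K) (n : ℕ) : Prop :=
  ∀ φ : Fml, IsSigma n φ → ∀ v : ℕ → S.M,
    (Sat0 S v φ ↔ Sat0 K (fun i => e.j (v i)) φ)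

/-- `K ⊨ M‑IΣₙ` (for an extension `e : M → K`): induction up to any `a ∈ M`
for `Σₙ` formulas with parameters from `K`. -/
def MISigma {S K : Str} (e : Emb S K) (n : ℕ) : Prop :=
  ∀ φ : Fml, IsSigma n φ → ∀ (v : ℕ → K.M) (x : ℕ) (a : S.M),
    Sat0 K (upd v x K.zero) φ →
    (∀ m, K.lt m (e.j a) → (Sat0 K (upd v x m) φ → Sat0 K (upd v x (K.add m K.one)) φ)) →
    ∀ m, K.lt m (e.j a) → Sat0 K (upd v x m) φ

/-- The `x`-th binary digit of `c ∈ K` is `1`, computed via a `Δ₀` definition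
`E` of exponentiation on the ground model `S` (here `x` lies under the image
of `S`): there are `x', p ∈ M` with `j x' = x`, `p = 2 ^ x'`, and `u, v ∈ K`
with `c = u·(2p) + p + v` and `v < p`. -/
def BitVia {S K : Str} (e : Emb S K) (E : Fml) (x c : K.M) : Prop :=
  ∃ x' p : S.M, e.j x' = x ∧ ExpAt S E (S.add S.one S.one) x' p ∧
    ∃ u v : K.M, K.lt v (e.j p) ∧
      c = K.add (K.add (K.mul u (K.add (e.j p) (e.j p))) (e.j p)) v

/-! ## The second-order restricted ultrapower -/

/-- `A` is cofinal (unbounded) in `S`. -/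
def Cofinal (S : Str) (A : Set S.M) : Prop := ∀ b : S.M, ∃ x ∈ A, S.lt b x

/-- The pairing term `⟨x, y⟩ = (x + y)·(x + y) + x`. -/
def pairS (S : Str) (x y : S.M) : S.M := S.add (S.mul (S.add x y) (S.add x y)) x

/-- The graph of `f : M → M`, coded as a subset of `M` via pairing. -/
def graphOf (S : Str) (f : S.M → S.M) : Set S.M := {m | ∃ x, m = pairS S x (f x)}

/-- `f` is a total function `M → M` lying in the second-order universe `X`
(its coded graph belongs to `X`).  The collection of such `f` is the class
`ℱ` of the restricted ultrapower. -/
def FuncIn (S : Str) (X : Set (Set S.M)) (f : S.M → S.M) : Prop := graphOf S f ∈ X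

/-- `U` is an ultrafilter on the Boolean algebra `X`, all of whose elements
are cofinal in `M`. -/
structure UltraOn (S : Str) (X U : Set (Set S.M)) : Prop where
  subset : U ⊆ X
  univ_mem : Set.univ ∈ U
  empty_not_mem : ∅ ∉ U
  inter_mem : ∀ A ∈ U, ∀ B ∈ U, A ∩ B ∈ U
  superset_mem : ∀ A ∈ U, ∀ B ∈ X, A ⊆ B → B ∈ U
  ultra : ∀ A ∈ X, A ∈ U ∨ Aᶜ ∈ U
  cofinal : ∀ A ∈ U, Cofinal S A

/-- A realization of the second-order restricted ultrapower `ℱ/𝒰` of `S`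
with respect to the second-order universe `X` and the ultrafilter `U`:
a structure `K` whose elements are exactly the classes `cls f hf = [f]` of
total functions `f ∈ ℱ`, where `[f] = [g]` iff `f = g` on a set in `U`, with
pointwise arithmetic operations, order decided by `U`, and the inherited
second-order membership relation `memK` serving as the second-order expansion. -/
structure RUP (S : Str) (X U : Set (Set S.M)) : Type 1 where
  K : Str
  cls : (f : S.M → S.M) → FuncIn S X f → K.M
  memK : K.M → Set S.M → Prop
  const_in : ∀ a : S.M, FuncIn S X (fun _ => a)
  surj : ∀ b : K.M, ∃ (f : S.M → S.M) (hf : FuncIn S X f), cls f hf = b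
  eq_iff : ∀ (f : S.M → S.M) (hf : FuncIn S X f) (g : S.M → S.M) (hg : FuncIn S X g),
      (cls f hf = cls g hg) ↔ {i : S.M | f i = g i} ∈ U
  lt_iff : ∀ (f : S.M → S.M) (hf : FuncIn S X f) (g : S.M → S.M) (hg : FuncIn S X g),
      K.lt (cls f hf) (cls g hg) ↔ {i : S.M | S.lt (f i) (g i)} ∈ U
  zero_eq : K.zero = cls (fun _ => S.zero) (const_in S.zero)
  one_eq : K.one = cls (fun _ => S.one) (const_in S.one)
  add_eq : ∀ (f : S.M → S.M) (hf : FuncIn S X f) (g : S.M → S.M) (hg : FuncIn S X g)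
      (h : S.M → S.M) (hh : FuncIn S X h), (∀ i, h i = S.add (f i) (g i)) →
      K.add (cls f hf) (cls g hg) = cls h hh
  mul_eq : ∀ (f : S.M → S.M) (hf : FuncIn S X f) (g : S.M → S.M) (hg : FuncIn S X g)
      (h : S.M → S.M) (hh : FuncIn S X h), (∀ i, h i = S.mul (f i) (g i)) →
      K.mul (cls f hf) (cls g hg) = cls h hh
  mem_iff : ∀ (f : S.M → S.M) (hf : FuncIn S X f) (A : Set S.M), A ∈ X →
      (memK (cls f hf) A ↔ {i : S.M | f i ∈ A} ∈ U)

/-- The canonical embedding `M → ℱ/𝒰` via constant functions. -/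
def RUP.emb {S : Str} {X U : Set (Set S.M)} (R : RUP S X U) (a : S.M) : R.K.M :=
  R.cls (fun _ => a) (R.const_in a)

/-- The subset of `ℱ/𝒰` induced by `A ⊆ M`. -/
def RUP.setImg {S : Str} {X U : Set (Set S.M)} (R : RUP S X U) (A : Set S.M) :
    Set R.K.M := {b | R.memK b A}

/-- The second-order part of the expanded ultrapower `(ℱ/𝒰, 𝒳)`:
the (injected) copy of `X`. -/
def RUP.X2 {S : Str} {X U : Set (Set S.M)} (R : RUP S X U) : Set (Set R.K.M) :=
  (fun A => R.setImg A) '' X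

end PaperArith

namespace PaperArith

/-! ## Arithmetic in models of `PA⁻` -/

section PAminus

variable {S : Str}

/-- The commutative semiring structure of a model of `PA⁻`. -/
@[reducible] def PAminus.commSemiring (h : PAminus S) : CommSemiring S.M where
  add := S.add
  zero := S.zero
  mul := S.mul
  one := S.one
  nsmul := @nsmulRec _ ⟨S.zero⟩ ⟨S.add⟩
  add_assoc := h.add_assoc
  zero_add a := (h.add_comm _ _).trans (h.add_zero a)
  add_zero := h.add_zero
  add_comm := h.add_comm
  left_distrib := h.distrib
  right_distrib a b c := by
    change S.mul (S.add a b) c = S.add (S.mul a c) (S.mul b c)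
    rw [h.mul_comm, h.distrib, h.mul_comm c a, h.mul_comm c b]
  zero_mul a := (h.mul_comm _ _).trans (h.mul_zero a)
  mul_zero := h.mul_zero
  mul_assoc := h.mul_assoc
  one_mul a := (h.mul_comm _ _).trans (h.mul_one a)
  mul_one := h.mul_one
  mul_comm := h.mul_comm

open Classical in
/-- The linear order of a model of `PA⁻`. -/
@[reducible] noncomputable def PAminus.linearOrder (h : PAminus S) : LinearOrder S.M where
  lt := S.lt
  le a b := S.lt a b ∨ a = b
  le_refl a := Or.inr rfl
  le_trans a b c hab hbc := by
    rcases hab with hab | rfl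
    · rcases hbc with hbc | rfl
      · exact Or.inl (h.lt_trans _ _ _ hab hbc)
      · exact Or.inl hab
    · exact hbc
  lt_iff_le_not_ge a b := by
    constructor
    · intro hab
      refine ⟨Or.inl hab, ?_⟩
      rintro (hba | rfl)
      · exact h.lt_irrefl _ (h.lt_trans _ _ _ hab hba)
      · exact h.lt_irrefl _ hab
    · rintro ⟨hab | rfl, hba⟩
      · exact hab
      · exact absurd (Or.inr rfl) hba
  le_antisymm a b hab hba := by
    rcases hab with hab | hab
    · rcases hba with hba | hba
      · exact absurd (h.lt_trans _ _ _ hab hba) (h.lt_irrefl _)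
      · exact hba.symm
    · exact hab
  le_total a b := by
    rcases h.lt_total a b with hab | hab | hab
    · exact Or.inl (Or.inl hab)
    · exact Or.inl (Or.inr hab)
    · exact Or.inr (Or.inl hab)
  toDecidableLE := Classical.decRel _

theorem PAminus.lt_succ_iff (h : PAminus S) (a b : S.M) :
    S.lt a (S.add b S.one) ↔ S.lt a b ∨ a = b := by
  have key : S.lt b (S.add b S.one) := by
    have := h.add_lt_add _ _ b h.zero_lt_one
    rwa [h.add_comm, h.add_zero, h.add_comm] at this
  constructor
  · intro hab
    rcases h.lt_total a b with hl | hl | hl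
    · exact Or.inl hl
    · exact Or.inr hl
    · rcases h.discrete _ _ hl with hd | hd
      · rw [hd] at hab
        exact absurd hab (h.lt_irrefl _)
      · exact absurd (h.lt_trans _ _ _ hab hd) (h.lt_irrefl _)
  · rintro (hab | rfl)
    · exact h.lt_trans _ _ _ hab key
    · exact key

theorem PAminus.not_lt_zero (h : PAminus S) (a : S.M) : ¬ S.lt a S.zero := by
  intro ha
  rcases h.zero_le a with rfl | h0
  · exact h.lt_irrefl _ ha
  · exact h.lt_irrefl _ (h.lt_trans _ _ _ ha h0)

/-- The ordered semiring structure of a model of `PA⁻`. -/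
theorem PAminus.isOrderedRing (h : PAminus S) :
    let _ := h.commSemiring
    let _ := h.linearOrder
    IsOrderedRing S.M := by
  let _ := h.commSemiring
  let _ := h.linearOrder
  have hadd : ∀ a b : S.M, a ≤ b → ∀ c, c + a ≤ c + b := by
    rintro a b (hab | rfl) c
    · left
      have := h.add_lt_add _ _ c hab
      rwa [h.add_comm a, h.add_comm b] at this
    · exact le_rfl
  have hmul : ∀ a : S.M, 0 ≤ a → ∀ b c : S.M, b ≤ c → b * a ≤ c * a := by
    rintro a (ha | rfl) b c (hbc | rfl)
    · exact Or.inl (h.mul_lt_mul _ _ _ hbc ha)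
    · exact le_rfl
    · exact le_of_eq ((h.mul_zero b).trans (h.mul_zero c).symm)
    · exact le_rfl
  exact
    { add_le_add_left := fun a b hab c => by
        rw [_root_.add_comm a, _root_.add_comm b]
        exact hadd a b hab c
      zero_le_one := Or.inl h.zero_lt_one
      mul_le_mul_of_nonneg_left := fun a ha b c hbc => by
        change a * b ≤ a * c
        rw [_root_.mul_comm a, _root_.mul_comm a]
        exact hmul a ha b c hbc
      mul_le_mul_of_nonneg_right := fun a ha b c hbc => hmul a ha b c hbc }

theorem PAminus.left_lt_pairS (h : PAminus S) (a b : S.M) :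
    S.lt a (S.add (pairS S a b) S.one) := by
  let _ := h.commSemiring
  let _ := h.linearOrder
  have := h.isOrderedRing
  have nn : ∀ c : S.M, 0 ≤ c := fun c => (h.zero_le c).elim (fun e => Or.inr e.symm) Or.inl
  rw [h.lt_succ_iff]
  change a ≤ (a + b) * (a + b) + a
  exact le_add_of_nonneg_left (nn _)

theorem PAminus.right_lt_pairS (h : PAminus S) (a b : S.M) :
    S.lt b (S.add (pairS S a b) S.one) := by
  let _ := h.commSemiring
  let _ := h.linearOrder
  have := h.isOrderedRing
  have nn : ∀ c : S.M, 0 ≤ c := fun c => (h.zero_le c).elim (fun e => Or.inr e.symm) Or.inl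
  rw [h.lt_succ_iff]
  change b ≤ (a + b) * (a + b) + a
  have hb : b ≤ b * b := by
    rcases h.zero_le b with rfl | hb
    · exact nn _
    · have h1 : (1 : S.M) ≤ b := by
        rcases h.discrete _ _ hb with e | e
        · exact le_of_eq ((zero_add (1 : S.M)).symm.trans e)
        · exact le_of_lt (lt_of_eq_of_lt (zero_add (1 : S.M)).symm e)
      simpa using mul_le_mul_of_nonneg_right h1 (nn b)
  calc b ≤ b * b := hb
    _ ≤ (a + b) * (a + b) :=
      mul_le_mul (le_add_of_nonneg_left (nn _)) (le_add_of_nonneg_left (nn _)) (nn _) (nn _)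
    _ ≤ (a + b) * (a + b) + a := le_add_of_nonneg_right (nn _)

theorem PAminus.pairS_lt_of_add_lt (h : PAminus S) {a b c d : S.M}
    (hlt : S.lt (S.add a b) (S.add c d)) : S.lt (pairS S a b) (pairS S c d) := by
  let _ := h.commSemiring
  let _ := h.linearOrder
  have := h.isOrderedRing
  have nn : ∀ c : S.M, 0 ≤ c := fun c => (h.zero_le c).elim (fun e => Or.inr e.symm) Or.inl
  change (a + b) * (a + b) + a < (c + d) * (c + d) + c
  have hs : (a + b) + 1 ≤ c + d := by
    rcases h.discrete _ _ hlt with e | e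
    · exact le_of_eq e
    · exact le_of_lt e
  have hlt1 : ∀ x : S.M, x < x + 1 := fun x => (h.lt_succ_iff x x).2 (Or.inr rfl)
  calc (a + b) * (a + b) + a ≤ (a + b) * (a + b) + (a + b) + (a + b) := by
        rw [_root_.add_assoc ((a + b) * (a + b))]
        refine add_le_add le_rfl ?_
        exact (le_add_of_nonneg_right (nn b)).trans (le_add_of_nonneg_right (nn _))
    _ < (a + b) * (a + b) + (a + b) + (a + b) + 1 := hlt1 _
    _ = ((a + b) + 1) * ((a + b) + 1) := by ring
    _ ≤ (c + d) * (c + d) := mul_le_mul hs hs (nn _) (nn _)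
    _ ≤ (c + d) * (c + d) + c := le_add_of_nonneg_right (nn _)

theorem PAminus.add_left_cancel (h : PAminus S) {a b c : S.M}
    (e : S.add a b = S.add a c) : b = c := by
  rw [h.add_comm a b, h.add_comm a c] at e
  rcases h.lt_total b c with hl | hl | hl
  · have := h.add_lt_add _ _ a hl
    rw [e] at this
    exact absurd this (h.lt_irrefl _)
  · exact hl
  · have := h.add_lt_add _ _ a hl
    rw [e] at this
    exact absurd this (h.lt_irrefl _)

theorem PAminus.pairS_inj (h : PAminus S) {a b c d : S.M} :
    pairS S a b = pairS S c d ↔ a = c ∧ b = d := by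
  refine ⟨fun e => ?_, fun ⟨e₁, e₂⟩ => by rw [e₁, e₂]⟩
  rcases h.lt_total (S.add a b) (S.add c d) with hl | hl | hl
  · have := h.pairS_lt_of_add_lt hl
    rw [e] at this
    exact absurd this (h.lt_irrefl _)
  · have hac : a = c := by
      unfold pairS at e
      rw [hl] at e
      exact h.add_left_cancel e
    subst hac
    exact ⟨rfl, h.add_left_cancel hl⟩
  · have := h.pairS_lt_of_add_lt hl
    rw [e] at this
    exact absurd this (h.lt_irrefl _)

end PAminus

/-! ## Closure properties of the second-order universe -/

/-- The pairing function as a term operation. -/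
def pairT (t u : Term) : Term := .add (.mul (.add t u) (.add t u)) t

section Universe

variable {S : Str} {X : Set (Set S.M)}

@[simp] theorem tval_pairT (v : ℕ → S.M) (t u : Term) :
    tval S v (pairT t u) = pairS S (tval S v t) (tval S v u) := rfl

theorem Delta1CA.comp_delta0 (h : Delta1CA S X) {φ : Fml} (hφ : Delta0SO φ) (v : ℕ → S.M)
    {w : ℕ → Set S.M} (hw : ∀ i, w i ∈ X) (x : ℕ) :
    {m | Sat S X (upd v x m) w φ} ∈ X := by
  obtain ⟨A, hA, hm⟩ := h φ φ (.delta0 hφ) (.delta0 hφ) v w hw x fun _ => Iff.rfl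
  rwa [show {m | Sat S X (upd v x m) w φ} = A from Set.ext fun m => (hm m).symm]

theorem Delta1CA.compl (h : Delta1CA S X) {A : Set S.M} (hA : A ∈ X) : Aᶜ ∈ X :=
  h.comp_delta0 (.not (.mem (.var 0) 0)) (fun _ => S.zero) (w := fun _ => A) (fun _ => hA) 0

theorem Delta1CA.inter (h : Delta1CA S X) {A B : Set S.M} (hA : A ∈ X) (hB : B ∈ X) :
    A ∩ B ∈ X :=
  h.comp_delta0 (.and (.mem (.var 0) 0) (.mem (.var 0) 1)) (fun _ => S.zero)
    (w := fun i => if i = 0 then A else B) (fun i => by split_ifs <;> assumption) 0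

theorem Delta1CA.union (h : Delta1CA S X) {A B : Set S.M} (hA : A ∈ X) (hB : B ∈ X) :
    A ∪ B ∈ X :=
  h.comp_delta0 (.or (.mem (.var 0) 0) (.mem (.var 0) 1)) (fun _ => S.zero)
    (w := fun i => if i = 0 then A else B) (fun i => by split_ifs <;> assumption) 0

theorem mem_graphOf (hP : PAminus S) {f : S.M → S.M} {a b : S.M} :
    pairS S a b ∈ graphOf S f ↔ b = f a := by
  constructor
  · rintro ⟨x, hx⟩
    obtain ⟨rfl, rfl⟩ := hP.pairS_inj.1 hx
    rfl
  · rintro rfl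
    exact ⟨a, rfl⟩

/-- A function whose graph is described by a set of the universe belongs to the universe. -/
theorem FuncIn.of_mem {f : S.M → S.M} {B : Set S.M} (hB : B ∈ X)
    (h : ∀ z, z ∈ B ↔ ∃ i y, z = pairS S i y ∧ y = f i) : FuncIn S X f := by
  have : graphOf S f = B := by
    ext z
    rw [h]
    constructor
    · rintro ⟨x, hx⟩
      exact ⟨x, _, hx, rfl⟩
    · rintro ⟨i, y, hz, rfl⟩
      exact ⟨i, hz⟩
  unfold FuncIn
  rwa [this]

/-- Bounded search for a pair with a given code. -/
theorem PAminus.exists_pair_bounded (hP : PAminus S) {z : S.M} {P : S.M → S.M → Prop} :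
    (∃ i, S.lt i (S.add z S.one) ∧ ∃ y, S.lt y (S.add z S.one) ∧ z = pairS S i y ∧ P i y) ↔
      ∃ i y, z = pairS S i y ∧ P i y := by
  constructor
  · rintro ⟨i, -, y, -, h⟩
    exact ⟨i, y, h⟩
  · rintro ⟨i, y, rfl, h⟩
    exact ⟨i, hP.left_lt_pairS _ _, y, hP.right_lt_pairS _ _, rfl, h⟩

/-- Least witnesses exist for sets in the second-order universe. -/
theorem RCA0.exists_least (h : RCA0 S X) {E : Set S.M} (hE : E ∈ X) {i y : S.M}
    (hy : pairS S i y ∈ E) :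
    ∃ y, pairS S i y ∈ E ∧ ∀ y', S.lt y' y → pairS S i y' ∉ E := by
  obtain ⟨hP, hI, -⟩ := h
  by_contra! hno
  have key := hI (.ball 1 (.var 0) (.not (.mem (pairT (.var 2) (.var 1)) 0)))
    (.delta0 (.ball _ _ (.not (.mem _ _)))) (fun _ => i) (fun _ => E) (fun _ => hE) 0
  simp only [Sat, tval, tval_pairT, upd] at key
  norm_num at key
  have := key (fun m hm => absurd hm (hP.not_lt_zero m)) (fun m ih k hk hkE => by
    rcases (hP.lt_succ_iff _ _).1 hk with hk | rfl
    · exact ih k hk hkE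
    · obtain ⟨y', hy', hy'E⟩ := hno k hkE
      exact ih y' hy' hy'E) (S.add y S.one) y ((hP.lt_succ_iff _ _).2 (Or.inr rfl))
  exact this hy

/-- Uniformization of total relations in the second-order universe. -/
theorem RCA0.exists_func (h : RCA0 S X) {E : Set S.M} (hE : E ∈ X)
    (htot : ∀ i, ∃ y, pairS S i y ∈ E) :
    ∃ g : S.M → S.M, FuncIn S X g ∧ ∀ i, pairS S i (g i) ∈ E := by
  have hP := h.1
  choose g hg hmin using fun i => h.exists_least hE (htot i).choose_spec
  refine ⟨g, ?_, hg⟩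
  refine FuncIn.of_mem (h.2.2.comp_delta0 (φ := .bex 1 (.add (.var 0) .one)
    (.bex 2 (.add (.var 0) .one) (.and (.eq (.var 0) (pairT (.var 1) (.var 2)))
      (.and (.mem (pairT (.var 1) (.var 2)) 0)
        (.ball 3 (.var 2) (.not (.mem (pairT (.var 1) (.var 3)) 0)))))))
    (by repeat' constructor) (fun _ => S.zero) (w := fun _ => E) (fun _ => hE) 0) fun z => ?_
  simp only [Set.mem_ofPred_eq, Sat, tval, tval_pairT, upd, OfNat.ofNat_ne_zero,
    OfNat.ofNat_ne_one, if_false, if_true, one_ne_zero, zero_ne_one, OfNat.one_ne_ofNat,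
    OfNat.zero_ne_ofNat, Nat.reduceEqDiff]
  rw [hP.exists_pair_bounded (P := fun i y => pairS S i y ∈ E ∧
    ∀ m, S.lt m y → pairS S i m ∉ E)]
  refine exists_congr fun i => exists_congr fun y => and_congr_right fun _ => ?_
  constructor
  · rintro ⟨hyE, hy⟩
    rcases hP.lt_total y (g i) with hl | hl | hl
    · exact absurd hyE (hmin i y hl)
    · exact hl
    · exact absurd (hg i) (hy _ hl)
  · rintro rfl
    exact ⟨hg i, hmin i⟩

theorem RCA0.exists_unpair (h : RCA0 S X) (hne : X.Nonempty) :
    ∃ L R : S.M → S.M, FuncIn S X L ∧ FuncIn S X R ∧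
      (∀ a b, L (pairS S a b) = a) ∧ ∀ a b, R (pairS S a b) = b := by
  have hP := h.1
  obtain ⟨A, hA⟩ := hne
  have key : ∀ k : ℕ, k = 3 ∨ k = 4 → ∃ g : S.M → S.M, FuncIn S X g ∧
      ∀ a b, g (pairS S a b) = if k = 3 then a else b := by
    intro k hk
    have hE := h.2.2.comp_delta0 (φ := .bex 1 (.add (.var 0) .one)
      (.bex 2 (.add (.var 0) .one) (.and (.eq (.var 0) (pairT (.var 1) (.var 2)))
        (.ball 3 (.add (.var 1) .one) (.ball 4 (.add (.var 1) .one)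
          (.imp (.eq (.var 1) (pairT (.var 3) (.var 4))) (.eq (.var 2) (.var k))))))))
      (by repeat' constructor) (fun _ => S.zero) (w := fun _ => A) (fun _ => hA) 0
    set E := {m | Sat S X (upd (fun _ => S.zero) 0 m) (fun _ => A) _} with hEdef
    have hmem : ∀ z y, pairS S z y ∈ E ↔
        ∀ a b, z = pairS S a b → y = if k = 3 then a else b := by
      intro z y
      have aux : ∀ Q : S.M → S.M → Prop, (∀ a, S.lt a (S.add z S.one) →
          ∀ b, S.lt b (S.add z S.one) → z = pairS S a b → Q a b) ↔
          ∀ a b, z = pairS S a b → Q a b := by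
        refine fun Q => ⟨?_, fun hQ a _ b _ => hQ a b⟩
        rintro hQ a b rfl
        exact hQ a (hP.left_lt_pairS _ _) b (hP.right_lt_pairS _ _) rfl
      rw [hEdef]
      rcases hk with rfl | rfl <;>
      · simp only [Set.mem_ofPred_eq, Sat, tval, tval_pairT, upd]
        norm_num
        constructor
        · rintro ⟨i, -, y', -, e, hy⟩
          obtain ⟨rfl, rfl⟩ := hP.pairS_inj.1 e
          exact (aux _).1 hy
        · intro hy
          exact ⟨z, hP.left_lt_pairS _ _, y, hP.right_lt_pairS _ _, rfl, (aux _).2 hy⟩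
    obtain ⟨g, hg, hgE⟩ := h.exists_func hE fun i => by
      simp only [hmem]
      by_cases hi : ∃ a b, i = pairS S a b
      · obtain ⟨a, b, rfl⟩ := hi
        refine ⟨if k = 3 then a else b, fun a' b' e => ?_⟩
        obtain ⟨rfl, rfl⟩ := hP.pairS_inj.1 e
        rfl
      · exact ⟨S.zero, fun a b e => absurd ⟨a, b, e⟩ hi⟩
    exact ⟨g, hg, fun a b => (hmem _ _).1 (hgE _) a b rfl⟩
  obtain ⟨L, hL, hL'⟩ := key 3 (Or.inl rfl)
  obtain ⟨R, hR, hR'⟩ := key 4 (Or.inr rfl)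
  exact ⟨L, R, hL, hR, by simpa using hL', by simpa using hR'⟩

/-- Composition of functions in the second-order universe. -/
theorem RCA0.comp_mem (h : RCA0 S X) {f g : S.M → S.M} (hg : FuncIn S X g)
    (hf : FuncIn S X f) : FuncIn S X (fun i => g (f i)) := by
  have hP := h.1
  obtain ⟨B, hB, hm⟩ := h.2.2
    (.ex 3 (.bex 1 (.add (.var 0) .one) (.bex 2 (.add (.var 0) .one)
      (.and (.eq (.var 0) (pairT (.var 1) (.var 2)))
        (.and (.mem (pairT (.var 1) (.var 3)) 0) (.mem (pairT (.var 3) (.var 2)) 1))))))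
    (.all 3 (.bex 1 (.add (.var 0) .one) (.bex 2 (.add (.var 0) .one)
      (.and (.eq (.var 0) (pairT (.var 1) (.var 2)))
        (.imp (.mem (pairT (.var 1) (.var 3)) 0) (.mem (pairT (.var 3) (.var 2)) 1))))))
    (.ex _ (.delta0 (by repeat' constructor))) (.all _ (.delta0 (by repeat' constructor)))
    (fun _ => S.zero) (fun i => if i = 0 then graphOf S f else graphOf S g)
    (fun i => by split_ifs <;> assumption) 0 fun m => by
      simp only [Sat, tval, tval_pairT, upd]
      norm_num
      simp only [hP.exists_pair_bounded, mem_graphOf hP]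
      constructor
      · rintro ⟨_, i, _, rfl, rfl, rfl⟩ u
        exact ⟨i, _, rfl, fun e => by rw [e]⟩
      · intro hall
        obtain ⟨i, y, rfl, -⟩ := hall S.zero
        obtain ⟨i', y', e, h'⟩ := hall (f i)
        obtain ⟨rfl, rfl⟩ := hP.pairS_inj.1 e
        exact ⟨f i, i, y, rfl, rfl, h' rfl⟩
  refine FuncIn.of_mem hB fun z => ?_
  rw [hm]
  simp only [Sat, tval, tval_pairT, upd]
  norm_num
  simp only [hP.exists_pair_bounded, mem_graphOf hP]
  constructor
  · rintro ⟨_, i, _, e, rfl, rfl⟩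
    exact ⟨i, e⟩
  · rintro ⟨i, e⟩
    exact ⟨_, i, _, e, rfl, rfl⟩

theorem RCA0.preimage_mem (h : RCA0 S X) {f : S.M → S.M} {A : Set S.M}
    (hf : FuncIn S X f) (hA : A ∈ X) : {i | f i ∈ A} ∈ X := by
  have hP := h.1
  obtain ⟨B, hB, hm⟩ := h.2.2
    (.ex 1 (.and (.mem (pairT (.var 0) (.var 1)) 0) (.mem (.var 1) 1)))
    (.all 1 (.imp (.mem (pairT (.var 0) (.var 1)) 0) (.mem (.var 1) 1)))
    (.ex _ (.delta0 (by repeat' constructor))) (.all _ (.delta0 (by repeat' constructor)))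
    (fun _ => S.zero) (fun i => if i = 0 then graphOf S f else A)
    (fun i => by split_ifs <;> assumption) 0 fun m => by
      simp only [Sat, tval, tval_pairT, upd]
      norm_num
      simp only [mem_graphOf hP]
      simp
  convert hB using 1
  ext i
  rw [hm]
  simp only [Set.mem_ofPred_eq, Sat, tval, tval_pairT, upd]
  norm_num
  simp only [mem_graphOf hP]
  simp

/-- Closure of functions in the second-order universe under a binary term operation. -/
theorem RCA0.binop_mem (h : RCA0 S X) {op : S.M → S.M → S.M} {t : Term}
    (ht : ∀ v, tval S v t = op (v 3) (v 4)) {f g : S.M → S.M} (hf : FuncIn S X f)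
    (hg : FuncIn S X g) : FuncIn S X (fun i => op (f i) (g i)) := by
  have hP := h.1
  obtain ⟨B, hB, hm⟩ := h.2.2
    (.ex 3 (.ex 4 (.bex 1 (.add (.var 0) .one) (.bex 2 (.add (.var 0) .one)
      (.and (.eq (.var 0) (pairT (.var 1) (.var 2)))
        (.and (.mem (pairT (.var 1) (.var 3)) 0) (.and (.mem (pairT (.var 1) (.var 4)) 1)
          (.eq (.var 2) t))))))))
    (.all 3 (.all 4 (.bex 1 (.add (.var 0) .one) (.bex 2 (.add (.var 0) .one)
      (.and (.eq (.var 0) (pairT (.var 1) (.var 2)))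
        (.imp (.mem (pairT (.var 1) (.var 3)) 0) (.imp (.mem (pairT (.var 1) (.var 4)) 1)
          (.eq (.var 2) t))))))))
    (.ex _ (.ex _ (.delta0 (by repeat' constructor))))
    (.all _ (.all _ (.delta0 (by repeat' constructor))))
    (fun _ => S.zero) (fun i => if i = 0 then graphOf S f else graphOf S g)
    (fun i => by split_ifs <;> assumption) 0 fun m => by
      simp only [Sat, tval, tval_pairT, ht, upd]
      norm_num
      simp only [hP.exists_pair_bounded, mem_graphOf hP]
      constructor
      · rintro ⟨_, _, i, _, rfl, rfl, rfl, rfl⟩ u u'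
        exact ⟨i, _, rfl, fun e e' => by rw [e, e']⟩
      · intro hall
        obtain ⟨i, y, rfl, -⟩ := hall S.zero S.zero
        obtain ⟨i', y', e, h'⟩ := hall (f i) (g i)
        obtain ⟨rfl, rfl⟩ := hP.pairS_inj.1 e
        exact ⟨f i, g i, i, y, rfl, rfl, rfl, h' rfl rfl⟩
  refine FuncIn.of_mem hB fun z => ?_
  rw [hm]
  simp only [Sat, tval, tval_pairT, ht, upd]
  norm_num
  simp only [hP.exists_pair_bounded, mem_graphOf hP]
  constructor
  · rintro ⟨_, _, i, _, e, rfl, rfl, rfl⟩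
    exact ⟨i, e⟩
  · rintro ⟨i, e⟩
    exact ⟨_, _, i, _, e, rfl, rfl, rfl⟩

theorem RCA0.tval_mem (h : RCA0 S X) (hc : ∀ a : S.M, FuncIn S X fun _ => a)
    {f : ℕ → S.M → S.M} (hf : ∀ j, FuncIn S X (f j)) (t : Term) :
    FuncIn S X (fun i => tval S (fun j => f j i) t) := by
  induction t with
  | var k => exact hf k
  | zero => exact hc _
  | one => exact hc _
  | add t u iht ihu =>
    exact h.binop_mem (t := .add (.var 3) (.var 4)) (fun _ => rfl) iht ihu
  | mul t u iht ihu =>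
    exact h.binop_mem (t := .mul (.var 3) (.var 4)) (fun _ => rfl) iht ihu

end Universe

/-! ## Renaming and merging of variables -/

section Renaming

variable {S : Str}

/-- Renaming of the variables of a term. -/
def Term.rename (ρ : ℕ → ℕ) : Term → Term
  | .var i => .var (ρ i)
  | .zero => .zero
  | .one => .one
  | .add t u => .add (t.rename ρ) (u.rename ρ)
  | .mul t u => .mul (t.rename ρ) (u.rename ρ)

theorem tval_rename (v : ℕ → S.M) (ρ : ℕ → ℕ) (t : Term) :
    tval S v (t.rename ρ) = tval S (v ∘ ρ) t := by
  induction t <;> simp_all [Term.rename, tval]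

theorem upd_comp_fresh (v : ℕ → S.M) {ρ : ℕ → ℕ} {y : ℕ} (hρ : ∀ i, ρ i ≠ y) (x : ℕ) (m : S.M) :
    upd v y m ∘ upd ρ x y = upd (v ∘ ρ) x m := by
  funext i
  by_cases hi : i = x
  · simp [upd, hi]
  · simp [upd, hi, hρ i]

theorem upd_comm {α : Type} (v : ℕ → α) {x y : ℕ} (hxy : x ≠ y) (a b : α) :
    upd (upd v x a) y b = upd (upd v y b) x a := by
  funext i
  by_cases hx : i = x
  · subst hx
    simp [upd, hxy]
  · simp [upd, hx]

/-- The odd variables from `2 * k + 1` on are not in the range of `ρ`. -/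
def FreshFrom (ρ : ℕ → ℕ) (k : ℕ) : Prop := ∀ i, ∀ k', k ≤ k' → ρ i ≠ 2 * k' + 1

theorem FreshFrom.upd {ρ : ℕ → ℕ} {k : ℕ} (h : FreshFrom ρ k) (x : ℕ) :
    FreshFrom (upd ρ x (2 * k + 1)) (k + 1) := by
  intro i k' hk
  have := h i k' (by omega)
  unfold PaperArith.upd
  split_ifs <;> omega

theorem Delta0.exists_rename {φ : Fml} (hφ : Delta0 φ) :
    ∀ (ρ : ℕ → ℕ) (k : ℕ), FreshFrom ρ k →
      ∃ ψ, Delta0 ψ ∧ ∀ v : ℕ → S.M, Sat0 S v ψ ↔ Sat0 S (v ∘ ρ) φ := by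
  induction hφ with
  | eq t u =>
    exact fun ρ k _ => ⟨.eq (t.rename ρ) (u.rename ρ), .eq _ _, fun v => by
      simp [Sat0, Sat, tval_rename]⟩
  | lt t u =>
    exact fun ρ k _ => ⟨.lt (t.rename ρ) (u.rename ρ), .lt _ _, fun v => by
      simp [Sat0, Sat, tval_rename]⟩
  | not _ ih =>
    intro ρ k h
    obtain ⟨ψ, hψ, e⟩ := ih ρ k h
    exact ⟨.not ψ, .not hψ, fun v => not_congr (e v)⟩
  | and _ _ ih₁ ih₂ =>
    intro ρ k h
    obtain ⟨ψ₁, hψ₁, e₁⟩ := ih₁ ρ k h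
    obtain ⟨ψ₂, hψ₂, e₂⟩ := ih₂ ρ k h
    exact ⟨.and ψ₁ ψ₂, .and hψ₁ hψ₂, fun v => and_congr (e₁ v) (e₂ v)⟩
  | or _ _ ih₁ ih₂ =>
    intro ρ k h
    obtain ⟨ψ₁, hψ₁, e₁⟩ := ih₁ ρ k h
    obtain ⟨ψ₂, hψ₂, e₂⟩ := ih₂ ρ k h
    exact ⟨.or ψ₁ ψ₂, .or hψ₁ hψ₂, fun v => or_congr (e₁ v) (e₂ v)⟩
  | imp _ _ ih₁ ih₂ =>
    intro ρ k h
    obtain ⟨ψ₁, hψ₁, e₁⟩ := ih₁ ρ k h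
    obtain ⟨ψ₂, hψ₂, e₂⟩ := ih₂ ρ k h
    exact ⟨.imp ψ₁ ψ₂, .imp hψ₁ hψ₂, fun v => imp_congr (e₁ v) (e₂ v)⟩
  | ball x t _ ih =>
    intro ρ k h
    obtain ⟨ψ, hψ, e⟩ := ih _ _ (h.upd x)
    refine ⟨.ball (2 * k + 1) (t.rename ρ) ψ, .ball _ _ hψ, fun v => ?_⟩
    refine forall_congr' fun m => imp_congr (by rw [tval_rename]) ?_
    rw [← upd_comp_fresh v (fun i => h i k le_rfl)]
    exact e _
  | bex x t _ ih =>
    intro ρ k h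
    obtain ⟨ψ, hψ, e⟩ := ih _ _ (h.upd x)
    refine ⟨.bex (2 * k + 1) (t.rename ρ) ψ, .bex _ _ hψ, fun v => ?_⟩
    refine exists_congr fun m => and_congr (by rw [tval_rename]) ?_
    rw [← upd_comp_fresh v (fun i => h i k le_rfl)]
    exact e _

/-- `ψ` expresses `φ`, after renaming by `ρ` and reading the variables `0` and `2` off the pair
stored in the variable `4`. -/
def Unpacks (S : Str) (ρ : ℕ → ℕ) (φ ψ : Fml) : Prop :=
  ∀ (v : ℕ → S.M) (l r : S.M), v 4 = pairS S l r →
    (Sat0 S v ψ ↔ Sat0 S (upd (upd v 0 l) 2 r ∘ ρ) φ)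

theorem Delta0.exists_unpacks (hP : PAminus S) {φ : Fml} (hφ : Delta0 φ) {ρ : ℕ → ℕ} {k : ℕ}
    (h : FreshFrom ρ k) : ∃ ψ, Delta0 ψ ∧ Unpacks S ρ φ ψ := by
  obtain ⟨ψ, hψ, e⟩ := hφ.exists_rename (S := S) ρ k h
  refine ⟨.bex 0 (.add (.var 4) .one) (.bex 2 (.add (.var 4) .one)
    (.and (.eq (.var 4) (pairT (.var 0) (.var 2))) ψ)),
    .bex _ _ (.bex _ _ (.and (.eq _ _) hψ)), fun v l r hv => ?_⟩
  rw [← e]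
  simp only [Sat0, Sat, tval, tval_pairT]
  have h4 : ∀ m m', upd (upd v 0 m) 2 m' 4 = v 4 := fun _ _ => rfl
  have h4' : ∀ m, upd v 0 m 4 = v 4 := fun _ => rfl
  have h0 : ∀ m m', upd (upd v 0 m) 2 m' 0 = m := fun _ _ => rfl
  have h2 : ∀ m m', upd (upd v 0 m) 2 m' 2 = m' := fun _ _ => rfl
  simp only [h4, h4', h0, h2]
  rw [hP.exists_pair_bounded (P := fun m m' => Sat S ∅ (upd (upd v 0 m) 2 m') (fun _ => ∅) ψ)]
  constructor
  · rintro ⟨i, y, hi, hs⟩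
    obtain ⟨rfl, rfl⟩ := hP.pairS_inj.1 (hv.symm.trans hi)
    exact hs
  · exact fun hs => ⟨l, r, hv, hs⟩

theorem Unpacks.quantifier {ρ : ℕ → ℕ} {k x : ℕ} {φ ψ : Fml} (h : FreshFrom ρ k)
    (hu : Unpacks S (upd ρ x (2 * k + 1)) φ ψ) {v : ℕ → S.M} {l r : S.M}
    (hv : v 4 = pairS S l r) (m : S.M) :
    Sat0 S (upd v (2 * k + 1) m) ψ ↔ Sat0 S (upd (upd (upd v 0 l) 2 r ∘ ρ) x m) φ := by
  rw [hu _ l r (by simpa [upd, show 4 ≠ 2 * k + 1 by omega] using hv),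
    ← upd_comp_fresh _ (fun i => h i k le_rfl), upd_comm v (by omega : 2 * k + 1 ≠ 0),
    upd_comm _ (by omega : 2 * k + 1 ≠ 2)]

theorem IsSigma.exists_unpacks (hP : PAminus S) {n : ℕ} {φ : Fml} (hφ : IsSigma n φ) :
    ∀ (ρ : ℕ → ℕ) (k : ℕ), FreshFrom ρ k → ∃ ψ, IsSigma n ψ ∧ Unpacks S ρ φ ψ := by
  refine IsSigma.rec
    (motive_1 := fun n φ _ => ∀ (ρ : ℕ → ℕ) (k : ℕ), FreshFrom ρ k →
      ∃ ψ, IsSigma n ψ ∧ Unpacks S ρ φ ψ)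
    (motive_2 := fun n φ _ => ∀ (ρ : ℕ → ℕ) (k : ℕ), FreshFrom ρ k →
      ∃ ψ, IsPi n ψ ∧ Unpacks S ρ φ ψ) ?_ ?_ ?_ ?_ ?_ ?_ hφ
  · intro n φ h ρ k hρ
    obtain ⟨ψ, hψ, e⟩ := h.exists_unpacks hP hρ
    exact ⟨ψ, .delta0 hψ, e⟩
  · intro n φ _ ih ρ k hρ
    obtain ⟨ψ, hψ, e⟩ := ih ρ k hρ
    exact ⟨ψ, .ofPi hψ, e⟩
  · intro x n φ _ ih ρ k hρ
    obtain ⟨ψ, hψ, e⟩ := ih _ _ (hρ.upd x)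
    exact ⟨.ex (2 * k + 1) ψ, .ex _ hψ, fun v l r hv => exists_congr fun m =>
      e.quantifier hρ hv m⟩
  · intro n φ h ρ k hρ
    obtain ⟨ψ, hψ, e⟩ := h.exists_unpacks hP hρ
    exact ⟨ψ, .delta0 hψ, e⟩
  · intro n φ _ ih ρ k hρ
    obtain ⟨ψ, hψ, e⟩ := ih ρ k hρ
    exact ⟨ψ, .ofSigma hψ, e⟩
  · intro x n φ _ ih ρ k hρ
    obtain ⟨ψ, hψ, e⟩ := ih _ _ (hρ.upd x)
    exact ⟨.all (2 * k + 1) ψ, .all _ hψ, fun v l r hv => forall_congr' fun m =>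
      e.quantifier hρ hv m⟩

theorem IsSigma.exists_neg {n : ℕ} {φ : Fml} (hφ : IsSigma n φ) :
    ∃ ψ, IsPi n ψ ∧ ∀ v : ℕ → S.M, Sat0 S v ψ ↔ ¬ Sat0 S v φ := by
  refine IsSigma.rec
    (motive_1 := fun n φ _ => ∃ ψ, IsPi n ψ ∧ ∀ v : ℕ → S.M, Sat0 S v ψ ↔ ¬ Sat0 S v φ)
    (motive_2 := fun n φ _ => ∃ ψ, IsSigma n ψ ∧ ∀ v : ℕ → S.M, Sat0 S v ψ ↔ ¬ Sat0 S v φ)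
    ?_ ?_ ?_ ?_ ?_ ?_ hφ
  · exact fun {n φ} h => ⟨.not φ, .delta0 (.not h), fun v => Iff.rfl⟩
  · rintro n φ _ ⟨ψ, hψ, e⟩
    exact ⟨ψ, .ofSigma hψ, e⟩
  · rintro x n φ _ ⟨ψ, hψ, e⟩
    exact ⟨.all x ψ, .all x hψ, fun v => (forall_congr' fun m => e _).trans not_exists.symm⟩
  · exact fun {n φ} h => ⟨.not φ, .delta0 (.not h), fun v => Iff.rfl⟩
  · rintro n φ _ ⟨ψ, hψ, e⟩
    exact ⟨ψ, .ofPi hψ, e⟩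
  · rintro x n φ _ ⟨ψ, hψ, e⟩
    exact ⟨.ex x ψ, .ex x hψ, fun v => (exists_congr fun m => e _).trans not_forall.symm⟩

theorem IsPi.exists_neg {n : ℕ} {φ : Fml} (hφ : IsPi n φ) :
    ∃ ψ, IsSigma n ψ ∧ ∀ v : ℕ → S.M, Sat0 S v ψ ↔ ¬ Sat0 S v φ := by
  refine IsPi.rec
    (motive_1 := fun n φ _ => ∃ ψ, IsPi n ψ ∧ ∀ v : ℕ → S.M, Sat0 S v ψ ↔ ¬ Sat0 S v φ)
    (motive_2 := fun n φ _ => ∃ ψ, IsSigma n ψ ∧ ∀ v : ℕ → S.M, Sat0 S v ψ ↔ ¬ Sat0 S v φ)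
    (fun h => IsSigma.exists_neg (.delta0 h)) (fun h _ => (IsSigma.ofPi h).exists_neg)
    (fun x _ _ h _ => (IsSigma.ex x h).exists_neg) ?_ ?_ ?_ hφ
  · exact fun {n φ} h => ⟨.not φ, .delta0 (.not h), fun v => Iff.rfl⟩
  · rintro n φ _ ⟨ψ, hψ, e⟩
    exact ⟨ψ, .ofPi hψ, e⟩
  · rintro x n φ _ ⟨ψ, hψ, e⟩
    exact ⟨.ex x ψ, .ex x hψ, fun v => (exists_congr fun m => e _).trans not_forall.symm⟩

end Renaming

/-! ## Formulas whose truth sets lie in the second-order universe -/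

section TruthSets

variable {S : Str} {X : Set (Set S.M)}

/-- The set of indices at which `φ` holds of the pointwise values of `f`. -/
def truthSet (S : Str) (φ : Fml) (f : ℕ → S.M → S.M) : Set S.M :=
  {i | Sat0 S (fun j => f j i) φ}

/-- A sequence of functions in the second-order universe, almost all of which are constant. -/
def Admissible (S : Str) (X : Set (Set S.M)) (f : ℕ → S.M → S.M) : Prop :=
  (∀ j, FuncIn S X (f j)) ∧ ∃ s : Finset ℕ, ∀ j, j ∉ s → ∃ c, f j = fun _ => c

/-- All truth sets of `φ` belong to the second-order universe. -/
def HasTruthSets (S : Str) (X : Set (Set S.M)) (φ : Fml) : Prop :=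
  ∀ f, Admissible S X f → truthSet S φ f ∈ X

theorem HasTruthSets.not (hD : Delta1CA S X) {φ : Fml} (h : HasTruthSets S X φ) :
    HasTruthSets S X (.not φ) :=
  fun f hf => hD.compl (h f hf)

theorem truthSet_congr {φ ψ : Fml} (e : ∀ v : ℕ → S.M, Sat0 S v φ ↔ Sat0 S v ψ)
    (f : ℕ → S.M → S.M) : truthSet S φ f = truthSet S ψ f :=
  Set.ext fun _ => e _

theorem HasTruthSets.congr {φ ψ : Fml} (h : HasTruthSets S X φ)
    (e : ∀ v : ℕ → S.M, Sat0 S v φ ↔ Sat0 S v ψ) : HasTruthSets S X ψ :=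
  fun f hf => truthSet_congr e f ▸ h f hf

theorem Admissible.upd {f : ℕ → S.M → S.M} (hf : Admissible S X f) (x : ℕ) {g : S.M → S.M}
    (hg : FuncIn S X g) : Admissible S X (upd f x g) := by
  obtain ⟨hf, s, hs⟩ := hf
  refine ⟨fun j => ?_, insert x s, fun j hj => ?_⟩
  · unfold PaperArith.upd
    split_ifs
    exacts [hg, hf j]
  · rw [Finset.mem_insert, not_or] at hj
    simpa [PaperArith.upd, hj.1] using hs j hj.2

theorem Admissible.comp (h : RCA0 S X) {f : ℕ → S.M → S.M} (hf : Admissible S X f)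
    {g : S.M → S.M} (hg : FuncIn S X g) : Admissible S X (fun j i => f j (g i)) := by
  obtain ⟨hf, s, hs⟩ := hf
  refine ⟨fun j => h.comp_mem (hf j) hg, s, fun j hj => ?_⟩
  obtain ⟨c, hc⟩ := hs j hj
  exact ⟨c, by simp [hc]⟩

theorem upd_apply_fun (f : ℕ → S.M → S.M) (x : ℕ) (g : S.M → S.M) (i : S.M) :
    (fun j => upd f x g j i) = upd (fun j => f j i) x (g i) := by
  funext j
  unfold upd
  split_ifs <;> rfl

theorem SigmaCA.pred {n : ℕ} (h : Delta1CA S X) (hCA : SigmaCA S X (n + 1)) : SigmaCA S X n := by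
  intro φ hφ v x
  obtain ⟨ψ, hψ, e⟩ := hφ.exists_neg (S := S)
  obtain ⟨A, hA, hm⟩ := hCA ψ (.ofPi hψ) v x
  refine ⟨Aᶜ, h.compl hA, fun m => ?_⟩
  rw [Set.mem_compl_iff, hm, e, not_not]

theorem IsSigma.hasTruthSets (h : RCA0 S X) (hc : ∀ a : S.M, FuncIn S X fun _ => a) {n : ℕ}
    (hCA : SigmaCA S X n) {φ : Fml} (hφ : IsSigma n φ) : HasTruthSets S X φ := by
  have hP := h.1
  suffices key : ∀ N (φ : Fml), IsSigma n φ → ∀ (f : ℕ → S.M → S.M) (s : Finset ℕ),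
      s.card ≤ N + 1 → (∀ j, FuncIn S X (f j)) → (∀ j, j ∉ s → ∃ c, f j = fun _ => c) →
      truthSet S φ f ∈ X by
    rintro f ⟨hf, s, hs⟩
    exact key s.card φ hφ f s (Nat.le_succ _) hf hs
  intro N
  induction N with
  | zero =>
    intro φ hφ f s hs hf hsf
    obtain ⟨a, ha⟩ : ∃ a, ∀ j, j ≠ a → j ∉ s := by
      rcases s.eq_empty_or_nonempty with rfl | ⟨a, ha⟩
      · exact ⟨0, fun j _ => Finset.notMem_empty j⟩
      · exact ⟨a, fun j hj hjs => hj (Finset.card_le_one.1 hs j hjs a ha)⟩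
    obtain ⟨A, hA, hm⟩ := hCA φ hφ (fun j => f j S.zero) a
    convert h.preimage_mem (hf a) hA using 1
    ext i
    simp only [truthSet, Set.mem_ofPred_eq, hm]
    have : (fun j => f j i) = PaperArith.upd (fun j => f j S.zero) a (f a i) := by
      funext j
      by_cases hj : j = a
      · simp [upd, hj]
      · obtain ⟨c, hc⟩ := hsf j (ha j hj)
        simp [upd, hj, hc]
    rw [this]
  | succ N ih =>
    intro φ hφ f s hs hf hsf
    by_cases hlt : s.card ≤ N + 1
    · exact ih φ hφ f s hlt hf hsf
    obtain ⟨a, has, b, hbs, hab⟩ := Finset.one_lt_card.1 (by omega : 1 < s.card)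
    obtain ⟨ψ, hψ, e⟩ := hφ.exists_unpacks hP
      (fun i => if i = a then 0 else if i = b then 2 else 2 * i + 6) 0
      (fun i k' _ => by dsimp only; split_ifs <;> omega)
    have hpair : FuncIn S X (fun i => pairS S (f a i) (f b i)) :=
      h.binop_mem (op := pairS S) (t := pairT (.var 3) (.var 4)) (fun _ => rfl) (hf a) (hf b)
    let f' : ℕ → S.M → S.M := fun k =>
      if k = 4 then fun i => pairS S (f a i) (f b i)
      else if 6 ≤ k ∧ k % 2 = 0 ∧ (k - 6) / 2 ≠ a ∧ (k - 6) / 2 ≠ b then f ((k - 6) / 2)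
      else fun _ => S.zero
    have hT : truthSet S φ f = truthSet S ψ f' := by
      ext i
      refine Iff.symm ((e (fun k => f' k i) (f a i) (f b i) rfl).trans ?_)
      have : PaperArith.upd (PaperArith.upd (fun k => f' k i) 0 (f a i)) 2 (f b i) ∘
          (fun i => if i = a then 0 else if i = b then 2 else 2 * i + 6) =
          fun j => f j i := by
        funext j
        by_cases hja : j = a
        · simp [upd, hja]
        · by_cases hjb : j = b
          · simp [upd, hjb, hab.symm]
          · simp [upd, hja, hjb, f']
      rw [this]
      rfl
    rw [hT]
    refine ih ψ hψ f' (insert 4 (((s.erase a).erase b).image (2 * · + 6))) ?_ ?_ ?_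
    · refine (Finset.card_insert_le _ _).trans ?_
      have h1 := Finset.card_image_le (s := (s.erase a).erase b) (f := (2 * · + 6))
      rw [Finset.card_erase_of_mem (Finset.mem_erase.2 ⟨hab.symm, hbs⟩),
        Finset.card_erase_of_mem has] at h1
      omega
    · intro k
      dsimp only [f']
      split_ifs
      exacts [hpair, hf _, hc _]
    · intro k hk
      rw [Finset.mem_insert, not_or] at hk
      dsimp only [f']
      rw [if_neg hk.1]
      split_ifs with h6
      · refine hsf _ fun hmem => hk.2 ?_
        refine Finset.mem_image.2 ⟨(k - 6) / 2, ?_, by omega⟩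
        simp [h6, hmem]
      · exact ⟨_, rfl⟩

theorem IsPi.hasTruthSets (h : RCA0 S X) (hc : ∀ a : S.M, FuncIn S X fun _ => a) {n : ℕ}
    (hCA : SigmaCA S X n) {φ : Fml} (hφ : IsPi n φ) : HasTruthSets S X φ := by
  obtain ⟨ψ, hψ, e⟩ := hφ.exists_neg (S := S)
  exact ((hψ.hasTruthSets h hc hCA).not h.2.2).congr fun v => (not_congr (e v)).trans not_not

end TruthSets

/-! ## Łoś's theorem for the restricted ultrapower -/

section Los

variable {S : Str} {X U : Set (Set S.M)}

theorem UltraOn.compl_mem_iff (hU : UltraOn S X U) {A : Set S.M} (hA : A ∈ X) :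
    Aᶜ ∈ U ↔ A ∉ U := by
  refine ⟨fun hc h => hU.empty_not_mem ?_, (hU.ultra A hA).resolve_left⟩
  simpa using hU.inter_mem _ h _ hc

theorem UltraOn.inter_mem_iff (hU : UltraOn S X U) {A B : Set S.M} (hA : A ∈ X) (hB : B ∈ X) :
    A ∩ B ∈ U ↔ A ∈ U ∧ B ∈ U :=
  ⟨fun h => ⟨hU.superset_mem _ h _ hA Set.inter_subset_left,
    hU.superset_mem _ h _ hB Set.inter_subset_right⟩, fun h => hU.inter_mem _ h.1 _ h.2⟩

/-- The valuation `u` consists of the classes of the functions `f j`. -/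
def Represents (R : RUP S X U) (f : ℕ → S.M → S.M) (u : ℕ → R.K.M) : Prop :=
  ∀ j, ∃ hf, u j = R.cls (f j) hf

/-- Łoś's theorem for the formula `φ` and admissible sequences of functions. -/
def Los (R : RUP S X U) (φ : Fml) : Prop :=
  ∀ f u, Admissible S X f → Represents R f u → (Sat0 R.K u φ ↔ truthSet S φ f ∈ U)

theorem Represents.upd {R : RUP S X U} {f : ℕ → S.M → S.M} {u : ℕ → R.K.M}
    (hu : Represents R f u) (x : ℕ) {g : S.M → S.M} (hg : FuncIn S X g) :
    Represents R (upd f x g) (upd u x (R.cls g hg)) := by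
  intro j
  by_cases hj : j = x
  · subst hj
    simp [PaperArith.upd, hg]
  · simpa [PaperArith.upd, hj] using hu j

theorem Represents.tval (h : RCA0 S X) {R : RUP S X U} {f : ℕ → S.M → S.M} {u : ℕ → R.K.M}
    (hu : Represents R f u) (t : Term) :
    ∃ ht : FuncIn S X (fun i => tval S (fun j => f j i) t),
      tval R.K u t = R.cls (fun i => tval S (fun j => f j i) t) ht := by
  have hmem := h.tval_mem R.const_in (fun j => (hu j).1)
  refine ⟨hmem t, ?_⟩
  induction t with
  | var k => exact (hu k).2
  | zero => exact R.zero_eq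
  | one => exact R.one_eq
  | add t u iht ihu =>
    simp only [PaperArith.tval, iht, ihu]
    exact R.add_eq _ (hmem t) _ (hmem u) _ (hmem (t.add u)) fun _ => rfl
  | mul t u iht ihu =>
    simp only [PaperArith.tval, iht, ihu]
    exact R.mul_eq _ (hmem t) _ (hmem u) _ (hmem (t.mul u)) fun _ => rfl

theorem Los.congr {R : RUP S X U} {φ ψ : Fml} (h : Los R φ)
    (eK : ∀ u : ℕ → R.K.M, Sat0 R.K u φ ↔ Sat0 R.K u ψ)
    (e : ∀ v : ℕ → S.M, Sat0 S v φ ↔ Sat0 S v ψ) : Los R ψ := by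
  intro f u hf hu
  rw [← eK, h f u hf hu, truthSet_congr e]

theorem Los.not (hU : UltraOn S X U) {R : RUP S X U} {φ : Fml} (h : Los R φ)
    (hφ : HasTruthSets S X φ) : Los R (.not φ) :=
  fun f u hf hu => (not_congr (h f u hf hu)).trans (hU.compl_mem_iff (hφ f hf)).symm

theorem Los.and (hU : UltraOn S X U) {R : RUP S X U} {φ ψ : Fml} (h : Los R φ) (h' : Los R ψ)
    (hφ : HasTruthSets S X φ) (hψ : HasTruthSets S X ψ) : Los R (.and φ ψ) :=
  fun f u hf hu => (and_congr (h f u hf hu) (h' f u hf hu)).trans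
    (hU.inter_mem_iff (hφ f hf) (hψ f hf)).symm

/-- Skolem functions in the second-order universe for relations coded there. -/
theorem RCA0.exists_skolem (h : RCA0 S X) {L R : S.M → S.M} (hL : FuncIn S X L)
    (hLp : ∀ a b, L (pairS S a b) = a) (hRp : ∀ a b, R (pairS S a b) = b)
    {P : S.M → S.M → Prop} (hP : {e | P (L e) (R e)} ∈ X) (hD : {i | ∃ y, P i y} ∈ X) :
    ∃ g, FuncIn S X g ∧ ∀ i, (∃ y, P i y) → P i (g i) := by
  have hE := h.2.2.union hP (h.2.2.compl (h.preimage_mem hL hD))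
  obtain ⟨g, hg, hgE⟩ := h.exists_func hE fun i => by
    by_cases hi : ∃ y, P i y
    · obtain ⟨y, hy⟩ := hi
      exact ⟨y, Or.inl (by simpa [hLp, hRp] using hy)⟩
    · exact ⟨i, Or.inr (by simpa [hLp] using hi)⟩
  refine ⟨g, hg, fun i hi => ?_⟩
  rcases hgE i with hl | hr
  · simpa [hLp, hRp] using hl
  · exact absurd (by simpa [hLp] using hi) hr

theorem Admissible.exists_truthSet_pair (h : RCA0 S X) {f : ℕ → S.M → S.M}
    (hf : Admissible S X f) {φ : Fml} (hφ : HasTruthSets S X φ) (x : ℕ) {L R : S.M → S.M}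
    (hL : FuncIn S X L) (hR : FuncIn S X R) :
    {e | Sat0 S (PaperArith.upd (fun j => f j (L e)) x (R e)) φ} ∈ X := by
  convert hφ _ ((hf.comp h hL).upd x hR) using 1
  ext e
  simp only [truthSet, Set.mem_ofPred_eq, upd_apply_fun]

theorem Los.ex (h : RCA0 S X) (hU : UltraOn S X U) {R : RUP S X U} {φ : Fml} (x : ℕ)
    (hl : Los R φ) (hφ : HasTruthSets S X φ) (hex : HasTruthSets S X (.ex x φ)) :
    Los R (.ex x φ) := by
  intro f u hf hu
  constructor
  · rintro ⟨b, hb⟩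
    obtain ⟨g, hg, rfl⟩ := R.surj b
    refine hU.superset_mem _ ((hl _ _ (hf.upd x hg) (hu.upd x hg)).1 hb) _ (hex f hf) ?_
    intro i hi
    rw [truthSet, Set.mem_ofPred_eq, upd_apply_fun] at hi
    exact ⟨g i, hi⟩
  · intro hT
    obtain ⟨L, R', hL, hR, hLp, hRp⟩ := h.exists_unpair ⟨_, hU.subset hU.univ_mem⟩
    obtain ⟨g, hg, hgP⟩ := h.exists_skolem hL hLp hRp
      (P := fun i y => Sat0 S (upd (fun j => f j i) x y) φ)
      (hf.exists_truthSet_pair h hφ x hL hR) (hex f hf)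
    refine ⟨R.cls g hg, (hl _ _ (hf.upd x hg) (hu.upd x hg)).2
      (hU.superset_mem _ hT _ (hφ _ (hf.upd x hg)) fun i hi => ?_)⟩
    rw [truthSet, Set.mem_ofPred_eq, upd_apply_fun]
    exact hgP i hi

theorem lt_set_mem (hc : ∀ a : S.M, FuncIn S X fun _ => a)
    (hlt : HasTruthSets S X (.lt (.var 0) (.var 1))) {f g : S.M → S.M} (hf : FuncIn S X f)
    (hg : FuncIn S X g) : {i | S.lt (f i) (g i)} ∈ X := by
  have h0 : Admissible S X (fun _ _ => S.zero) := ⟨fun _ => hc _, ∅, fun _ _ => ⟨_, rfl⟩⟩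
  exact hlt _ ((h0.upd 0 hf).upd 1 hg)

theorem Los.bex (h : RCA0 S X) (hU : UltraOn S X U) {R : RUP S X U} {φ : Fml} (x : ℕ) (t : Term)
    (hlt : HasTruthSets S X (.lt (.var 0) (.var 1)))
    (hl : Los R φ) (hφ : HasTruthSets S X φ) (hex : HasTruthSets S X (.bex x t φ)) :
    Los R (.bex x t φ) := by
  intro f u hf hu
  obtain ⟨ht, htu⟩ := hu.tval h t
  constructor
  · rintro ⟨b, hbt, hb⟩
    obtain ⟨g, hg, rfl⟩ := R.surj b
    rw [htu, R.lt_iff] at hbt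
    refine hU.superset_mem _ (hU.inter_mem _ hbt _
      ((hl _ _ (hf.upd x hg) (hu.upd x hg)).1 hb)) _ (hex f hf) ?_
    rintro i ⟨hit, hi⟩
    rw [truthSet, Set.mem_ofPred_eq, upd_apply_fun] at hi
    exact ⟨g i, hit, hi⟩
  · intro hT
    obtain ⟨L, R', hL, hR, hLp, hRp⟩ := h.exists_unpair ⟨_, hU.subset hU.univ_mem⟩
    obtain ⟨g, hg, hgP⟩ := h.exists_skolem hL hLp hRp
      (P := fun i y => S.lt y (tval S (fun j => f j i) t) ∧
        Sat0 S (upd (fun j => f j i) x y) φ)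
      (h.2.2.inter (lt_set_mem R.const_in hlt hR (h.comp_mem ht hL))
        (hf.exists_truthSet_pair h hφ x hL hR)) (hex f hf)
    refine ⟨R.cls g hg, ?_, (hl _ _ (hf.upd x hg) (hu.upd x hg)).2
      (hU.superset_mem _ hT _ (hφ _ (hf.upd x hg)) fun i hi => ?_)⟩
    · rw [htu, R.lt_iff]
      exact hU.superset_mem _ hT _ (lt_set_mem R.const_in hlt hg ht) fun i hi => (hgP i hi).1
    · rw [truthSet, Set.mem_ofPred_eq, upd_apply_fun]
      exact (hgP i hi).2

theorem Delta0.los (h : RCA0 S X) (hU : UltraOn S X U) (R : RUP S X U)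
    (hT : ∀ {φ}, Delta0 φ → HasTruthSets S X φ) {φ : Fml} (hφ : Delta0 φ) : Los R φ := by
  induction hφ with
  | eq t t' =>
    intro f u hf hu
    obtain ⟨ht, e⟩ := hu.tval h t
    obtain ⟨ht', e'⟩ := hu.tval h t'
    simp only [Sat0, Sat]
    rw [e, e', R.eq_iff]
    rfl
  | lt t t' =>
    intro f u hf hu
    obtain ⟨ht, e⟩ := hu.tval h t
    obtain ⟨ht', e'⟩ := hu.tval h t'
    simp only [Sat0, Sat]
    rw [e, e', R.lt_iff]
    rfl
  | not hφ ih => exact ih.not hU (hT hφ)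
  | and hφ hψ ih ih' => exact ih.and hU ih' (hT hφ) (hT hψ)
  | or hφ hψ ih ih' =>
    exact (((ih.not hU (hT hφ)).and hU (ih'.not hU (hT hψ)) (hT hφ.not) (hT hψ.not)).not hU
      (hT (hφ.not.and hψ.not))).congr (fun u => by simp only [Sat0, Sat]; tauto)
      (fun u => by simp only [Sat0, Sat]; tauto)
  | imp hφ hψ ih ih' =>
    exact ((ih.and hU (ih'.not hU (hT hψ)) (hT hφ) (hT hψ.not)).not hU
      (hT (hφ.and hψ.not))).congr (fun u => by simp only [Sat0, Sat]; tauto)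
      (fun u => by simp only [Sat0, Sat]; tauto)
  | ball x t hφ ih =>
    exact (((ih.not hU (hT hφ)).bex h hU x t (hT (.lt _ _)) (hT hφ.not)
      (hT (.bex _ _ hφ.not))).not hU (hT (.bex _ _ hφ.not))).congr
      (fun u => by simp [Sat0, Sat]) (fun u => by simp [Sat0, Sat])
  | bex x t hφ ih =>
    exact ih.bex h hU x t (hT (.lt _ _)) (hT hφ) (hT (.bex _ _ hφ))

theorem Los.all (h : RCA0 S X) (hU : UltraOn S X U) {R : RUP S X U} {φ : Fml} (x : ℕ)
    (hl : Los R φ) (hφ : HasTruthSets S X φ) (hall : HasTruthSets S X (.all x φ)) :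
    Los R (.all x φ) := by
  have hex : HasTruthSets S X (.ex x (.not φ)) :=
    (hall.not h.2.2).congr fun v => by simp [Sat0, Sat]
  exact (((hl.not hU hφ).ex h hU x (hφ.not h.2.2) hex).not hU hex).congr
    (fun u => by simp [Sat0, Sat]) (fun u => by simp [Sat0, Sat])

/-- Łoś's theorem for `Σₙ` and `Πₙ` formulas under `Σₙ`-comprehension. -/
theorem RCA0.los (h : RCA0 S X) (hU : UltraOn S X U) (R : RUP S X U) :
    (∀ n φ, IsSigma n φ → SigmaCA S X n → Los R φ) ∧
      ∀ n φ, IsPi n φ → SigmaCA S X n → Los R φ := by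
  have hDelta : ∀ {n φ}, Delta0 φ → SigmaCA S X n → Los R φ := fun {n φ} hφ hCA =>
    hφ.los h hU R fun hψ => (IsSigma.delta0 (n := n) hψ).hasTruthSets h R.const_in hCA
  have hSigma : ∀ {n φ}, IsSigma n φ → SigmaCA S X n → HasTruthSets S X φ := fun hφ hCA =>
    hφ.hasTruthSets h R.const_in hCA
  have hPi : ∀ {n φ}, IsPi n φ → SigmaCA S X n → HasTruthSets S X φ := fun hφ hCA =>
    hφ.hasTruthSets h R.const_in hCA
  constructor
  · intro n φ hφ
    exact IsSigma.rec (motive_1 := fun n φ _ => SigmaCA S X n → Los R φ)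
      (motive_2 := fun n φ _ => SigmaCA S X n → Los R φ)
      (fun h0 => hDelta h0) (fun _ ih hCA => ih (hCA.pred h.2.2))
      (fun x _ _ hψ ih hCA => (ih hCA).ex h hU x (hSigma hψ hCA) (hSigma (.ex x hψ) hCA))
      (fun h0 => hDelta h0) (fun _ ih hCA => ih (hCA.pred h.2.2))
      (fun x _ _ hψ ih hCA => (ih hCA).all h hU x (hPi hψ hCA) (hPi (.all x hψ) hCA)) hφ
  · intro n φ hφ
    exact IsPi.rec (motive_1 := fun n φ _ => SigmaCA S X n → Los R φ)
      (motive_2 := fun n φ _ => SigmaCA S X n → Los R φ)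
      (fun h0 => hDelta h0) (fun _ ih hCA => ih (hCA.pred h.2.2))
      (fun x _ _ hψ ih hCA => (ih hCA).ex h hU x (hSigma hψ hCA) (hSigma (.ex x hψ) hCA))
      (fun h0 => hDelta h0) (fun _ ih hCA => ih (hCA.pred h.2.2))
      (fun x _ _ hψ ih hCA => (ih hCA).all h hU x (hPi hψ hCA) (hPi (.all x hψ) hCA)) hφ

end Los

/-- Lemma `lem:groundCA`.
Let `(M, 𝒳) ⊨ RCA₀`, `ℱ` the class of total functions `M → M` in `𝒳`, and
`𝒰` an ultrafilter on `𝒳` all of whose elements are cofinal in `M`.  For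
`n ≥ 1`, if `(M, 𝒳)` satisfies `Σₙ`-comprehension, then every instance of
`Σₙ`- and `Πₙ`-comprehension true in `(M, 𝒳)` transfers to the restricted
ultrapower `(ℱ/𝒰, 𝒳)`. -/
theorem statement_4 (S : Str) (X U : Set (Set S.M))
    (hRCA : RCA0 S X) (hU : UltraOn S X U) (R : RUP S X U)
    (n : ℕ) (hn : 1 ≤ n) (hCA : SigmaCA S X n) :
    ∀ φ : Fml, (IsSigma n φ ∨ IsPi n φ) →
      ∀ (v : ℕ → S.M) (x : ℕ) (A : Set S.M), A ∈ X →
        (∀ m : S.M, m ∈ A ↔ Sat0 S (upd v x m) φ) →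
        ∀ b : R.K.M, (R.memK b A ↔ Sat0 R.K (upd (fun k => R.emb (v k)) x b) φ) := by
  intro φ hφ v x A hA hm b
  obtain ⟨g, hg, rfl⟩ := R.surj b
  have hlos : Los R φ := by
    obtain ⟨hσ, hπ⟩ := hRCA.los hU R
    exact hφ.elim (fun h => hσ n φ h hCA) (fun h => hπ n φ h hCA)
  have hadm : Admissible S X (fun j _ => v j) := ⟨fun j => R.const_in _, ∅, fun j _ => ⟨_, rfl⟩⟩
  have hrep : Represents R (fun j _ => v j) (fun k => R.emb (v k)) :=
    fun j => ⟨R.const_in _, rfl⟩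
  rw [hlos _ _ (hadm.upd x hg) (hrep.upd x hg), R.mem_iff g hg A hA]
  have : truthSet S φ (upd (fun j _ => v j) x g) = {i | g i ∈ A} := by
    ext i
    rw [truthSet, Set.mem_ofPred_eq, upd_apply_fun, Set.mem_ofPred_eq, hm]
  rw [this]

end PaperArith
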